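/- arXiv:math/0505130 — 2 statements merged into one kernel-verified Lean document; each statement's English description precedes it below -/
import Mathlib

section
/- A finite connected simple graph has adjacency-matrix spectral radius strictly less than 2 if and only if it is one of the graphs A_n (n ≥ 1), D_n (n ≥ 4), E_6, E_7, E_8, or the tadpole graphs T_n; the bipartite ones among these are exactly the A-D-E Dynkin diagrams. -/
/-- Adjacency matrix of the Dynkin diagram `A_N` (path on `N` vertices). -/
def pathAdj (N : ℕ) : Matrix (Fin N) (Fin N) ℝ :=
  Matrix.of fun i j => if (i : ℕ) + 1 = j ∨ (j : ℕ) + 1 = i then 1 else 0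

/-- Adjacency matrix of the Dynkin diagram `D_N`: a path on the vertices
`0, 1, …, N-2` together with the extra vertex `N-1` attached to vertex `1`. -/
def dAdj (N : ℕ) : Matrix (Fin N) (Fin N) ℝ :=
  Matrix.of fun i j =>
    if (((i : ℕ) + 1 = j ∧ (j : ℕ) ≤ N - 2) ∨ ((j : ℕ) + 1 = i ∧ (i : ℕ) ≤ N - 2)) ∨
        (((i : ℕ) = 1 ∧ (j : ℕ) = N - 1) ∨ ((j : ℕ) = 1 ∧ (i : ℕ) = N - 1)) then 1 else 0

/-- Adjacency matrix of the Dynkin diagram `E_N` (`N = 6, 7, 8`). -/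
def eAdj (N : ℕ) : Matrix (Fin N) (Fin N) ℝ :=
  Matrix.of fun i j =>
    if (((i : ℕ) + 1 = j ∧ (j : ℕ) ≤ N - 2) ∨ ((j : ℕ) + 1 = i ∧ (i : ℕ) ≤ N - 2)) ∨
        (((i : ℕ) = 2 ∧ (j : ℕ) = N - 1) ∨ ((j : ℕ) = 2 ∧ (i : ℕ) = N - 1)) then 1 else 0

/-- Adjacency matrix of the tadpole graph `T_N`: the path on `N` vertices
with a loop attached at vertex `0`. -/
def tadpoleAdj (N : ℕ) : Matrix (Fin N) (Fin N) ℝ :=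
  Matrix.of fun i j =>
    if (i : ℕ) + 1 = j ∨ (j : ℕ) + 1 = i ∨ ((i : ℕ) = 0 ∧ (j : ℕ) = 0) then 1 else 0

/-- `Δ` is the adjacency matrix of a graph (symmetric with `{0,1}` entries,
loops allowed). -/
def IsGraphMatrix {N : ℕ} (Δ : Matrix (Fin N) (Fin N) ℝ) : Prop :=
  Δ.IsSymm ∧ ∀ i j, Δ i j = 0 ∨ Δ i j = 1

/-- The graph with adjacency matrix `Δ` is connected. -/
def IsConnectedMatrix {N : ℕ} (Δ : Matrix (Fin N) (Fin N) ℝ) : Prop :=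
  ∀ i j : Fin N, ∃ k : ℕ, (Δ ^ k) i j ≠ 0

/-- All eigenvalues of `Δ` have absolute value `< 2` (spectral radius `< 2`). -/
def SpectralRadiusLtTwo {N : ℕ} (Δ : Matrix (Fin N) (Fin N) ℝ) : Prop :=
  ∀ r : ℝ, (∃ v : Fin N → ℝ, v ≠ 0 ∧ Δ.mulVec v = r • v) → |r| < 2

/-- The graph with adjacency matrix `Δ` is bipartite. -/
def IsBipartiteMatrix {N : ℕ} (Δ : Matrix (Fin N) (Fin N) ℝ) : Prop :=
  ∃ f : Fin N → Bool, ∀ i j, Δ i j ≠ 0 → f i ≠ f j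

/-- The graph with adjacency matrix `Δ` is isomorphic to one of the
A-D-E Dynkin diagrams. -/
def IsADEMatrix {N : ℕ} (Δ : Matrix (Fin N) (Fin N) ℝ) : Prop :=
  ∃ σ : Equiv.Perm (Fin N),
    (∀ i j, Δ i j = pathAdj N (σ i) (σ j)) ∨
    (4 ≤ N ∧ ∀ i j, Δ i j = dAdj N (σ i) (σ j)) ∨
    ((N = 6 ∨ N = 7 ∨ N = 8) ∧ ∀ i j, Δ i j = eAdj N (σ i) (σ j))

/-- The graph with adjacency matrix `Δ` is isomorphic to one of the
A-D-E Dynkin diagrams or to a tadpole graph. -/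
def IsADETMatrix {N : ℕ} (Δ : Matrix (Fin N) (Fin N) ℝ) : Prop :=
  IsADEMatrix Δ ∨ ∃ σ : Equiv.Perm (Fin N), ∀ i j, Δ i j = tadpoleAdj N (σ i) (σ j)

theorem SpectralRadiusLtTwo.dotProduct_mulVec_lt {N : ℕ} {Δ : Matrix (Fin N) (Fin N) ℝ}
    (hs : Δ.IsSymm) (h : SpectralRadiusLtTwo Δ) {u : Fin N → ℝ} (hu : u ≠ 0) :
    u ⬝ᵥ Δ.mulVec u < 2 * (u ⬝ᵥ u) := by
  have hH : ((2 : ℝ) • (1 : Matrix (Fin N) (Fin N) ℝ) - Δ).IsHermitian := by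
    rw [Matrix.IsHermitian, Matrix.conjTranspose_eq_transpose_of_trivial]
    simp [hs.eq]
  have hP : ((2 : ℝ) • (1 : Matrix (Fin N) (Fin N) ℝ) - Δ).PosDef := by
    rw [hH.posDef_iff_eigenvalues_pos]
    intro i
    have hv := hH.mulVec_eigenvectorBasis i
    have hne : (hH.eigenvectorBasis i).ofLp ≠ 0 := by
      intro h0
      exact hH.eigenvectorBasis.toBasis.ne_zero i (by ext j; simpa using congrFun h0 j)
    rw [Matrix.sub_mulVec, Matrix.smul_mulVec, Matrix.one_mulVec] at hv
    have := h (2 - hH.eigenvalues i) ⟨_, hne, by rw [sub_smul, ← hv]; simp⟩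
    rw [abs_lt] at this
    linarith [this.2]
  have := hP.dotProduct_mulVec_pos hu
  rw [star_trivial, Matrix.sub_mulVec, Matrix.smul_mulVec, Matrix.one_mulVec, dotProduct_sub,
    dotProduct_smul, smul_eq_mul] at this
  linarith

/-- A nonnegative integral weight, supported on distinct vertices `g t` with `t ∈ S`, such that the
weights of some neighbours of each vertex add up to at least twice its own weight, cannot exist on a
graph of spectral radius less than two. -/
theorem SpectralRadiusLtTwo.false_of_weight {N : ℕ} {Δ : Matrix (Fin N) (Fin N) ℝ}
    (hg : IsGraphMatrix Δ) (h : SpectralRadiusLtTwo Δ) (S : Finset ℕ) (g : ℕ → Fin N)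
    (hinj : Set.InjOn g S) (c : ℕ → ℕ) {t₀ : ℕ} (ht₀ : t₀ ∈ S) (hc : c t₀ ≠ 0)
    (hw : ∀ t ∈ S, ∃ T ⊆ S, (∀ s ∈ T, Δ (g t) (g s) = 1) ∧ 2 * c t ≤ ∑ s ∈ T, c s) : False := by
  classical
  have hnn : ∀ i j, 0 ≤ Δ i j := fun i j => by rcases hg.2 i j with h | h <;> simp [h]
  set U : Fin N → ℝ := fun v => ∑ s ∈ S, if g s = v then (c s : ℝ) else 0 with hU
  have hU0 : ∀ v, 0 ≤ U v := fun v => Finset.sum_nonneg fun s _ => by split_ifs <;> simp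
  have hUg : ∀ t ∈ S, U (g t) = c t := by
    intro t ht
    rw [hU]
    dsimp only
    rw [Finset.sum_eq_single_of_mem t ht, if_pos rfl]
    intro s hs hst
    rw [if_neg fun e => hst (hinj hs ht e)]
  have hne : U ≠ 0 := fun e => hc <| by
    have := hUg t₀ ht₀
    rw [e] at this
    simpa using this.symm
  have hlt := h.dotProduct_mulVec_lt hg.1 hne
  refine absurd hlt (not_lt.2 ?_)
  rw [dotProduct, dotProduct, Finset.mul_sum]
  refine Finset.sum_le_sum fun v _ => ?_
  by_cases hv : ∃ t ∈ S, g t = v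
  · obtain ⟨t, ht, rfl⟩ := hv
    obtain ⟨T, hTS, hT, hle⟩ := hw t ht
    have h1 : (2 * c t : ℝ) ≤ Δ.mulVec U (g t) := by
      calc (2 * c t : ℝ) ≤ ∑ s ∈ T, (c s : ℝ) := by exact_mod_cast hle
        _ = ∑ s ∈ T, Δ (g t) (g s) * U (g s) :=
          Finset.sum_congr rfl fun s hs => by rw [hT s hs, hUg s (hTS hs), one_mul]
        _ = ∑ w ∈ T.image g, Δ (g t) w * U w :=
          (Finset.sum_image (f := fun w => Δ (g t) w * U w)
            fun a ha b hb e => hinj (hTS ha) (hTS hb) e).symm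
        _ ≤ ∑ w, Δ (g t) w * U w :=
          Finset.sum_le_sum_of_subset_of_nonneg (Finset.subset_univ _)
            fun w _ _ => mul_nonneg (hnn _ _) (hU0 w)
    nlinarith [hU0 (g t), hUg t ht, mul_le_mul_of_nonneg_left h1 (hU0 (g t))]
  · have : U v = 0 := Finset.sum_eq_zero fun s hs => if_neg fun e => hv ⟨s, hs, e⟩
    simp [this]

theorem spectralRadiusLtTwo_of_weight {N : ℕ} {Δ : Matrix (Fin N) (Fin N) ℝ}
    (hs : Δ.IsSymm) (B : ℕ → ℕ → Prop) [DecidableRel B] (σ : Equiv.Perm (Fin N))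
    (hB : ∀ i j, Δ i j = if B (σ i) (σ j) then 1 else 0) (w : ℕ → ℤ) (hpos : ∀ i < N, 0 < w i)
    (hw : ∀ i < N, ∃ T : Finset ℕ, (∀ j ∈ T, 0 ≤ w j) ∧ (∀ j < N, B i j → j ∈ T) ∧
      ∑ j ∈ T, w j < 2 * w i) : SpectralRadiusLtTwo Δ := by
  have hΔ : ∀ i j, 0 ≤ Δ i j := fun i j => by rw [hB]; split_ifs <;> simp
  have key : ∀ i, ∑ j, Δ i j * (w (σ j) : ℝ) < 2 * (w (σ i) : ℝ) := by
    intro i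
    obtain ⟨T, hT0, hT, hlt⟩ := hw (σ i) (σ i).2
    have e : ∑ j, Δ i j * (w (σ j) : ℝ) =
        ((∑ j ∈ (Finset.range N).filter (fun j => B (σ i) j), w j : ℤ) : ℝ) := by
      simp_rw [hB, ite_mul, one_mul, zero_mul]
      rw [Equiv.sum_comp σ (fun j : Fin N => if B (σ i) j then (w j : ℝ) else 0),
        Fin.sum_univ_eq_sum_range (fun j => if B (σ i) j then (w j : ℝ) else 0),
        ← Finset.sum_filter]
      push_cast
      rfl
    rw [e]
    have : ∑ j ∈ (Finset.range N).filter (fun j => B (σ i) j), w j ≤ ∑ j ∈ T, w j :=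
      Finset.sum_le_sum_of_subset_of_nonneg (fun j hj => by
        simp only [Finset.mem_filter, Finset.mem_range] at hj
        exact hT j hj.1 hj.2) fun j hj _ => hT0 j hj
    exact_mod_cast this.trans_lt hlt
  rintro r ⟨v, hv0, hv⟩
  by_contra! hr
  have hwp : ∀ i, 0 < (w (σ i) : ℝ) := fun i => by exact_mod_cast hpos _ (σ i).2
  have h1 : ∀ i, 2 * |v i| ≤ ∑ j, Δ i j * |v j| := by
    intro i
    calc 2 * |v i| ≤ |r| * |v i| := by gcongr
      _ = |∑ j, Δ i j * v j| := by
        rw [← abs_mul]; exact congrArg _ (congrFun hv i).symm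
      _ ≤ ∑ j, |Δ i j * v j| := Finset.abs_sum_le_sum_abs _ _
      _ = ∑ j, Δ i j * |v j| := by simp_rw [abs_mul, abs_of_nonneg (hΔ _ _)]
  have h2 : ∑ i, (w (σ i) : ℝ) * (2 * |v i|) ≤ ∑ j, |v j| * ∑ i, Δ j i * (w (σ i) : ℝ) := by
    calc _ ≤ ∑ i, (w (σ i) : ℝ) * ∑ j, Δ i j * |v j| :=
          Finset.sum_le_sum fun i _ => mul_le_mul_of_nonneg_left (h1 i) (hwp i).le
      _ = _ := by
        simp_rw [Finset.mul_sum]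
        rw [Finset.sum_comm]
        refine Finset.sum_congr rfl fun j _ => Finset.sum_congr rfl fun i _ => ?_
        rw [hs.apply i j]
        ring
  obtain ⟨k, hk⟩ := Function.ne_iff.1 hv0
  have h3 : ∑ j, |v j| * ∑ i, Δ j i * (w (σ i) : ℝ) < ∑ i, (w (σ i) : ℝ) * (2 * |v i|) := by
    refine Finset.sum_lt_sum (fun j _ => ?_) ⟨k, Finset.mem_univ _, ?_⟩
    · nlinarith [mul_le_mul_of_nonneg_left (key j).le (abs_nonneg (v j))]
    · nlinarith [mul_lt_mul_of_pos_left (key k) (abs_pos.2 hk)]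
  linarith

/-- Adjacency in the path on the natural numbers. -/
abbrev PathRel (i j : ℕ) : Prop := i + 1 = j ∨ j + 1 = i

/-- Adjacency in the path `0, …, N - 2` with the extra vertex `N - 1` attached to vertex `b`. -/
abbrev BranchRel (b N i j : ℕ) : Prop :=
  ((i + 1 = j ∧ j ≤ N - 2) ∨ (j + 1 = i ∧ i ≤ N - 2)) ∨ ((i = b ∧ j = N - 1) ∨ (j = b ∧ i = N - 1))

/-- Adjacency in the path on the natural numbers with a loop at `0`. -/
abbrev TadpoleRel (i j : ℕ) : Prop := i + 1 = j ∨ j + 1 = i ∨ (i = 0 ∧ j = 0)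

theorem IsADETMatrix.spectralRadiusLtTwo {N : ℕ} {Δ : Matrix (Fin N) (Fin N) ℝ}
    (hs : Δ.IsSymm) (h : IsADETMatrix Δ) : SpectralRadiusLtTwo Δ := by
  rcases h with ⟨σ, h | ⟨hN, h⟩ | ⟨hN, h⟩⟩ | ⟨σ, h⟩
  · refine spectralRadiusLtTwo_of_weight hs PathRel σ h (fun i => (i + 1) * (N - i)) ?_ ?_
    · intro i hi
      have : (i : ℤ) < N := by exact_mod_cast hi
      exact mul_pos (by positivity) (by linarith)
    · rintro (_ | k) hi
      · refine ⟨{1}, ?_, ?_, ?_⟩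
        · have : (1 : ℤ) ≤ N := by exact_mod_cast hi
          simpa using by linarith
        · intro j _ hj
          simp only [Finset.mem_singleton]
          omega
        · simp
      · have hk : (k : ℤ) + 2 ≤ N := by exact_mod_cast hi
        refine ⟨{k, k + 2}, ?_, ?_, ?_⟩
        · intro j hj
          simp only [Finset.mem_insert, Finset.mem_singleton] at hj
          rcases hj with rfl | rfl <;> exact mul_nonneg (by positivity) (by push_cast; linarith)
        · intro j _ hj
          simp only [Finset.mem_insert, Finset.mem_singleton]
          omega
        · rw [Finset.sum_pair (by omega)]
          push_cast
          nlinarith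
  · have hN' : (4 : ℤ) ≤ N := by exact_mod_cast hN
    refine spectralRadiusLtTwo_of_weight hs (BranchRel 1 N) σ h
      (fun i => if i = 0 ∨ i = N - 1 then N * (N - 1) else 2 * ((N - 1 - i) * (N + i))) ?_ ?_
    · intro i hi
      have hi' : (i : ℤ) + 1 ≤ N := by exact_mod_cast hi
      split_ifs with h0
      · nlinarith
      · have : (i : ℤ) + 2 ≤ N := by omega
        exact mul_pos (by norm_num) (mul_pos (by linarith) (by positivity))
    · have w1 : ¬ (1 = 0 ∨ 1 = N - 1) := by omega
      have hlt : 2 * ((N - 1 - (1 : ℕ)) * (N + (1 : ℕ))) < 2 * ((N : ℤ) * (N - 1)) := by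
        push_cast
        nlinarith
      have h1 : 0 ≤ 2 * (((N : ℤ) - 1 - (1 : ℕ)) * (N + (1 : ℕ))) :=
        mul_nonneg (by norm_num) (mul_nonneg (by push_cast; linarith) (by positivity))
      intro i hi
      by_cases hend : i = 0 ∨ i = N - 1
      · refine ⟨{1}, ?_, ?_, ?_⟩
        · simp only [Finset.mem_singleton, forall_eq, if_neg w1]
          exact h1
        · intro j _ hj
          simp only [Finset.mem_singleton]
          omega
        · simp only [Finset.sum_singleton, if_neg w1, if_pos hend]
          exact hlt
      obtain ⟨k, rfl⟩ : ∃ k, i = k + 1 := ⟨i - 1, by omega⟩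
      rcases Nat.eq_zero_or_pos k with rfl | hk
      · have w2 : ¬ (2 = 0 ∨ 2 = N - 1) := by omega
        refine ⟨{0, 2, N - 1}, ?_, ?_, ?_⟩
        · simp only [Finset.mem_insert, Finset.mem_singleton, forall_eq_or_imp, forall_eq, if_neg w2,
            true_or, or_true, if_true]
          refine ⟨by nlinarith, ?_, by nlinarith⟩
          exact mul_nonneg (by norm_num) (mul_nonneg (by push_cast; linarith) (by positivity))
        · intro j _ hj
          simp only [Finset.mem_insert, Finset.mem_singleton]
          omega
        · rw [Finset.sum_insert (by simp; omega), Finset.sum_pair (by omega)]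
          simp only [if_neg w2, if_neg hend, true_or, or_true, if_true]
          push_cast
          nlinarith
      have hk0 : ¬ (k = 0 ∨ k = N - 1) := by omega
      have hkN : (k : ℤ) + 3 ≤ N := by omega
      have hk1 : 0 ≤ 2 * (((N : ℤ) - 1 - k) * (N + k)) :=
        mul_nonneg (by norm_num) (mul_nonneg (by linarith) (by positivity))
      by_cases hlast : k + 2 = N - 1
      · refine ⟨{k}, ?_, ?_, ?_⟩
        · simp only [Finset.mem_singleton, forall_eq, if_neg hk0]
          exact hk1
        · intro j _ hj
          simp only [Finset.mem_singleton]
          omega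
        · simp only [Finset.sum_singleton, if_neg hk0, if_neg hend]
          have : (N : ℤ) = k + 3 := by omega
          rw [this]
          push_cast
          nlinarith
      · have hk2 : ¬ (k + 2 = 0 ∨ k + 2 = N - 1) := by omega
        refine ⟨{k, k + 2}, ?_, ?_, ?_⟩
        · simp only [Finset.mem_insert, Finset.mem_singleton, forall_eq_or_imp, forall_eq,
            if_neg hk0, if_neg hk2]
          exact ⟨hk1, mul_nonneg (by norm_num) (mul_nonneg (by push_cast; linarith) (by positivity))⟩
        · intro j _ hj
          simp only [Finset.mem_insert, Finset.mem_singleton]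
          omega
        · rw [Finset.sum_pair (by omega)]
          simp only [if_neg hk0, if_neg hk2, if_neg hend]
          push_cast
          nlinarith
  · rcases hN with rfl | rfl | rfl
    · exact spectralRadiusLtTwo_of_weight hs (BranchRel 2 6) σ h (fun i => [16, 30, 42, 30, 16, 22].getD i 0)
        (by decide) fun i hi => ⟨(Finset.range 6).filter (BranchRel 2 6 i), by
            revert i; decide,
          fun j hj hB => Finset.mem_filter.2 ⟨Finset.mem_range.2 hj, hB⟩, by
            revert i; decide⟩
    · exact spectralRadiusLtTwo_of_weight hs (BranchRel 2 7) σ h (fun i => [34, 66, 96, 75, 52, 27, 49].getD i 0)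
        (by decide) fun i hi => ⟨(Finset.range 7).filter (BranchRel 2 7 i), by
            revert i; decide,
          fun j hj hB => Finset.mem_filter.2 ⟨Finset.mem_range.2 hj, hB⟩, by
            revert i; decide⟩
    · exact spectralRadiusLtTwo_of_weight hs (BranchRel 2 8) σ h
        (fun i => [92, 182, 270, 220, 168, 114, 58, 136].getD i 0)
        (by decide) fun i hi => ⟨(Finset.range 8).filter (BranchRel 2 8 i), by
            revert i; decide,
          fun j hj hB => Finset.mem_filter.2 ⟨Finset.mem_range.2 hj, hB⟩, by
            revert i; decide⟩
  · refine spectralRadiusLtTwo_of_weight hs TadpoleRel σ h (fun i => (N - i) * (N + 1 + i)) ?_ ?_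
    · intro i hi
      have : (i : ℤ) < N := by exact_mod_cast hi
      exact mul_pos (by linarith) (by positivity)
    · rintro (_ | k) hi
      · have : (1 : ℤ) ≤ N := by exact_mod_cast hi
        refine ⟨{0, 1}, ?_, ?_, ?_⟩
        · intro j hj
          simp only [Finset.mem_insert, Finset.mem_singleton] at hj
          rcases hj with rfl | rfl <;> exact mul_nonneg (by push_cast; linarith) (by positivity)
        · intro j _ hj
          simp only [Finset.mem_insert, Finset.mem_singleton]
          omega
        · rw [Finset.sum_pair (by omega)]
          push_cast
          nlinarith
      · have hk : (k : ℤ) + 2 ≤ N := by exact_mod_cast hi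
        refine ⟨{k, k + 2}, ?_, ?_, ?_⟩
        · intro j hj
          simp only [Finset.mem_insert, Finset.mem_singleton] at hj
          rcases hj with rfl | rfl <;> exact mul_nonneg (by push_cast; linarith) (by positivity)
        · intro j _ hj
          simp only [Finset.mem_insert, Finset.mem_singleton]
          omega
        · rw [Finset.sum_pair (by omega)]
          push_cast
          nlinarith

/-- The vertices `p 0, …, p m` are distinct and consecutive ones are adjacent. -/
def IsPathIn {N : ℕ} (Δ : Matrix (Fin N) (Fin N) ℝ) (p : ℕ → Fin N) (m : ℕ) : Prop :=
  Set.InjOn p (Set.Iic m) ∧ ∀ i < m, Δ (p i) (p (i + 1)) = 1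

/-- The sequence which agrees with `p` up to `m` and is `x` afterwards. -/
def extendBy {N : ℕ} (p : ℕ → Fin N) (m : ℕ) (x : Fin N) (t : ℕ) : Fin N :=
  if t ≤ m then p t else x

section Paths

variable {N : ℕ} {Δ : Matrix (Fin N) (Fin N) ℝ} {p : ℕ → Fin N} {m : ℕ} {x y : Fin N}

theorem extendBy_of_le {t : ℕ} (h : t ≤ m) : extendBy p m x t = p t := if_pos h

theorem extendBy_of_lt {t : ℕ} (h : m < t) : extendBy p m x t = x := if_neg (by omega)

theorem injOn_extendBy (hp : Set.InjOn p (Set.Iic m)) (hx : ∀ t ≤ m, p t ≠ x) :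
    Set.InjOn (extendBy p m x) (Set.Iic (m + 1)) := by
  intro s hs t ht e
  rw [Set.mem_Iic] at hs ht
  rcases Nat.lt_or_ge m s with h1 | h1 <;> rcases Nat.lt_or_ge m t with h2 | h2
  · omega
  · rw [extendBy_of_lt h1, extendBy_of_le h2] at e
    exact absurd e.symm (hx t h2)
  · rw [extendBy_of_le h1, extendBy_of_lt h2] at e
    exact absurd e (hx s h1)
  · rw [extendBy_of_le h1, extendBy_of_le h2] at e
    exact hp h1 h2 e

theorem IsPathIn.append (hp : IsPathIn Δ p m) (hx : ∀ t ≤ m, p t ≠ x) (hadj : Δ (p m) x = 1) :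
    IsPathIn Δ (extendBy p m x) (m + 1) := by
  refine ⟨injOn_extendBy hp.1 hx, fun i hi => ?_⟩
  rw [extendBy_of_le (by omega : i ≤ m)]
  rcases Nat.lt_or_ge i m with h | h
  · rw [extendBy_of_le h]
    exact hp.2 i h
  · rw [extendBy_of_lt (by omega), show i = m by omega]
    exact hadj

theorem IsPathIn.reverse (hs : Δ.IsSymm) (hp : IsPathIn Δ p m) :
    IsPathIn Δ (fun t => p (m - t)) m := by
  refine ⟨fun s hs t ht e => ?_, fun i hi => ?_⟩
  · rw [Set.mem_Iic] at hs ht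
    have := hp.1 (Set.mem_Iic.2 (Nat.sub_le m s)) (Set.mem_Iic.2 (Nat.sub_le m t)) e
    omega
  · have := hp.2 (m - (i + 1)) (by omega)
    rw [show m - (i + 1) + 1 = m - i by omega] at this
    rw [← this, hs.apply]

theorem IsPathIn.shift (hp : IsPathIn Δ p m) (a : ℕ) {k : ℕ} (h : a + k ≤ m) :
    IsPathIn Δ (fun t => p (a + t)) k := by
  refine ⟨fun s hs t ht e => ?_, fun i hi => hp.2 (a + i) (by omega)⟩
  rw [Set.mem_Iic] at hs ht
  have := hp.1 (Set.mem_Iic.2 (by omega)) (Set.mem_Iic.2 (by omega)) e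
  omega

theorem IsPathIn.mono (hp : IsPathIn Δ p m) {k : ℕ} (h : k ≤ m) : IsPathIn Δ p k :=
  ⟨hp.1.mono (Set.Iic_subset_Iic.2 h), fun i hi => hp.2 i (by omega)⟩

theorem IsPathIn.lt (hp : IsPathIn Δ p m) : m < N := by
  have := Finset.card_le_card_of_injOn (s := Finset.Iic m) (t := Finset.univ) p (by simp)
    (by simpa using hp.1)
  simpa using this

theorem IsPathIn.adj_of_pathRel (hs : Δ.IsSymm) (hp : IsPathIn Δ p m) {s t : ℕ} (hsm : s ≤ m)
    (ht : t ≤ m) (h : PathRel s t) : Δ (p s) (p t) = 1 := by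
  rcases h with rfl | rfl
  · exact hp.2 s ht
  · rw [hs.apply]
    exact hp.2 t hsm

theorem IsPathIn.adj_of_branchRel (hs : Δ.IsSymm) (hp : IsPathIn Δ p m) {i s t : ℕ} (hi : i ≤ m)
    (hadj : Δ (p i) x = 1) (h : BranchRel i (m + 2) s t) :
    Δ (extendBy p m x s) (extendBy p m x t) = 1 := by
  rcases h with h | ⟨rfl, rfl⟩ | ⟨rfl, rfl⟩
  · rw [extendBy_of_le (by omega), extendBy_of_le (by omega)]
    exact hp.adj_of_pathRel hs (by omega) (by omega) (by omega)
  · rw [extendBy_of_le (by omega), extendBy_of_lt (by omega)]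
    exact hadj
  · rw [extendBy_of_lt (by omega), extendBy_of_le (by omega), hs.apply]
    exact hadj

/-- Among the paths satisfying a given condition there is a longest one. -/
theorem exists_longest_path (P : (ℕ → Fin N) → Prop) (hP : ∃ p, P p) :
    ∃ m p, P p ∧ IsPathIn Δ p m ∧ ∀ q k, P q → IsPathIn Δ q k → k ≤ m := by
  set A : Set ℕ := {m | ∃ p, P p ∧ IsPathIn Δ p m} with hA
  obtain ⟨p₀, hp₀⟩ := hP
  have hne : A.Nonempty := ⟨0, p₀, hp₀, fun s hs t ht _ => by
    rw [Set.mem_Iic] at hs ht; omega, by simp⟩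
  have hbd : BddAbove A := ⟨N, fun m ⟨p, _, hp⟩ => hp.lt.le⟩
  obtain ⟨p, hPp, hp⟩ := Nat.sSup_mem hne hbd
  exact ⟨sSup A, p, hPp, hp, fun q k hq hk => le_csSup hbd ⟨q, hq, hk⟩⟩

theorem IsConnectedMatrix.exists_adj (hg : IsGraphMatrix Δ) (hc : IsConnectedMatrix Δ)
    {S : Set (Fin N)} {a b : Fin N} (ha : a ∈ S) (hb : b ∉ S) :
    ∃ u ∈ S, ∃ v ∉ S, Δ u v = 1 := by
  by_contra! hcon
  have key : ∀ k : ℕ, ∀ j ∉ S, (Δ ^ k) a j = 0 := by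
    intro k
    induction k with
    | zero =>
      intro j hj
      rw [pow_zero, Matrix.one_apply_ne]
      rintro rfl
      exact hj ha
    | succ k ih =>
      intro j hj
      rw [pow_succ, Matrix.mul_apply]
      refine Finset.sum_eq_zero fun l _ => ?_
      by_cases hl : l ∈ S
      · rw [(hg.2 l j).resolve_right (hcon l hl j hj), mul_zero]
      · rw [ih l hl, zero_mul]
  obtain ⟨k, hk⟩ := hc a b
  exact hk (key k b hb)

theorem exists_perm_of_labelling (hg : IsGraphMatrix Δ) {g : ℕ → Fin N} {M : ℕ}
    (hinj : Set.InjOn g (Set.Iic M)) (hsurj : ∀ v, ∃ t ≤ M, g t = v) (R : ℕ → ℕ → Prop)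
    [DecidableRel R] (hR : ∀ s ≤ M, ∀ t ≤ M, Δ (g s) (g t) = 1 ↔ R s t) :
    N = M + 1 ∧ ∃ σ : Equiv.Perm (Fin N), ∀ i j, Δ i j = if R (σ i) (σ j) then 1 else 0 := by
  have hbij : Function.Bijective fun t : Fin (M + 1) => g t := by
    refine ⟨fun s t e => Fin.ext (hinj (Set.mem_Iic.2 (by omega)) (Set.mem_Iic.2 (by omega)) e),
      fun v => ?_⟩
    obtain ⟨t, ht, rfl⟩ := hsurj v
    exact ⟨⟨t, by omega⟩, rfl⟩
  obtain rfl : N = M + 1 := by simpa using (Fintype.card_of_bijective hbij).symm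
  refine ⟨rfl, (Equiv.ofBijective _ hbij).symm, fun i j => ?_⟩
  obtain ⟨s, rfl⟩ := hbij.2 i
  obtain ⟨t, rfl⟩ := hbij.2 j
  rw [Equiv.ofBijective_symm_apply_apply, Equiv.ofBijective_symm_apply_apply]
  have := hR s (by omega) t (by omega)
  split_ifs with h
  · exact this.2 h
  · exact (hg.2 _ _).resolve_right fun e => h (this.1 e)

/-! ### Subgraphs excluded by the bound on the spectral radius -/

theorem IsPathIn.false_of_cycle (hg : IsGraphMatrix Δ) (h : SpectralRadiusLtTwo Δ)
    (hp : IsPathIn Δ p m) (hm : 2 ≤ m) (hadj : Δ (p m) (p 0) = 1) : False := by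
  refine h.false_of_weight hg (Finset.Iic m) p (by simpa using hp.1) (fun _ => 1)
    (t₀ := 0) (by simp) one_ne_zero fun t ht => ?_
  rw [Finset.mem_Iic] at ht
  refine ⟨{if t = 0 then m else t - 1, if t = m then 0 else t + 1}, ?_, ?_, ?_⟩
  · intro s hs
    simp only [Finset.mem_insert, Finset.mem_singleton] at hs
    rw [Finset.mem_Iic]
    split_ifs at hs <;> omega
  · intro s hs
    simp only [Finset.mem_insert, Finset.mem_singleton] at hs
    by_cases h1 : t = 0 ∧ s = m
    · rw [h1.1, h1.2, hg.1.apply]; exact hadj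
    by_cases h2 : t = m ∧ s = 0
    · rw [h2.1, h2.2]; exact hadj
    refine hp.adj_of_pathRel hg.1 ht ?_ ?_ <;> split_ifs at hs <;> omega
  · rw [Finset.sum_pair (by split_ifs <;> omega)]

theorem IsPathIn.adj_iff (hg : IsGraphMatrix Δ) (h : SpectralRadiusLtTwo Δ)
    (hp : IsPathIn Δ p m) {s t : ℕ} (hs : s ≤ m) (ht : t ≤ m) (hst : s ≠ t) :
    Δ (p s) (p t) = 1 ↔ PathRel s t := by
  refine ⟨fun e => ?_, hp.adj_of_pathRel hg.1 hs ht⟩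
  wlog hlt : s < t generalizing s t
  · have := this ht hs hst.symm (by rwa [hg.1.apply]) (by omega)
    omega
  by_contra hcon
  refine (hp.shift s (k := t - s) (by omega)).false_of_cycle hg h (by omega) ?_
  rw [hg.1.apply, show s + (t - s) = t by omega]
  exact e

theorem IsPathIn.eq_of_adj (hg : IsGraphMatrix Δ) (h : SpectralRadiusLtTwo Δ)
    (hp : IsPathIn Δ p m) (hx : ∀ t ≤ m, p t ≠ x) {i j : ℕ} (hi : i ≤ m) (hj : j ≤ m)
    (hix : Δ (p i) x = 1) (hjx : Δ (p j) x = 1) : i = j := by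
  wlog hlt : i < j generalizing i j
  · by_contra hne
    exact hne (this hj hi hjx hix (by omega)).symm
  have h1 : IsPathIn Δ (extendBy (fun t => p (i + t)) (j - i) x) (j - i + 1) := by
    refine (hp.shift i (k := j - i) (by omega)).append (fun t ht => hx _ (by omega)) ?_
    rw [show i + (j - i) = j by omega]
    exact hjx
  refine (h1.false_of_cycle hg h (by omega) ?_).elim
  rw [extendBy_of_lt (by omega), extendBy_of_le (by omega), hg.1.apply]
  exact hix

theorem IsPathIn.false_of_loops (hg : IsGraphMatrix Δ) (h : SpectralRadiusLtTwo Δ)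
    (hp : IsPathIn Δ p m) (hm : 1 ≤ m) (h0 : Δ (p 0) (p 0) = 1) (h1 : Δ (p m) (p m) = 1) :
    False := by
  refine h.false_of_weight hg (Finset.Iic m) p (by simpa using hp.1) (fun _ => 1)
    (t₀ := 0) (by simp) one_ne_zero fun t ht => ?_
  rw [Finset.mem_Iic] at ht
  refine ⟨{if t = 0 then 0 else t - 1, if t = m then m else t + 1}, ?_, ?_, ?_⟩
  · intro s hs
    simp only [Finset.mem_insert, Finset.mem_singleton] at hs
    rw [Finset.mem_Iic]
    split_ifs at hs <;> omega
  · intro s hs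
    simp only [Finset.mem_insert, Finset.mem_singleton] at hs
    by_cases h2 : t = 0 ∧ s = 0
    · rw [h2.1, h2.2]; exact h0
    by_cases h3 : t = m ∧ s = m
    · rw [h3.1, h3.2]; exact h1
    refine hp.adj_of_pathRel hg.1 ht ?_ ?_ <;> split_ifs at hs <;> omega
  · rw [Finset.sum_pair (by split_ifs <;> omega)]

theorem IsPathIn.false_of_loop_of_fork (hg : IsGraphMatrix Δ) (h : SpectralRadiusLtTwo Δ)
    (hp : IsPathIn Δ p (m + 1)) (h0 : Δ (p 0) (p 0) = 1) (hx : ∀ t ≤ m + 1, p t ≠ x)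
    (hadj : Δ (p m) x = 1) : False := by
  refine h.false_of_weight hg (Finset.Iic (m + 2)) (extendBy p (m + 1) x)
    (by simpa using injOn_extendBy hp.1 hx) (fun t => if t ≤ m then 2 else 1)
    (t₀ := 0) (by simp) (by simp) fun t ht => ?_
  have hB : ∀ s t, BranchRel m (m + 3) s t →
      Δ (extendBy p (m + 1) x s) (extendBy p (m + 1) x t) = 1 :=
    fun s t => hp.adj_of_branchRel hg.1 (by omega) hadj
  have hL : Δ (extendBy p (m + 1) x 0) (extendBy p (m + 1) x 0) = 1 := by
    rwa [extendBy_of_le (by omega)]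
  rw [Finset.mem_Iic] at ht
  rcases Nat.lt_trichotomy t m with htm | rfl | htm
  · refine ⟨{t - 1, t + 1}, ?_, ?_, ?_⟩
    · intro s hs
      simp only [Finset.mem_insert, Finset.mem_singleton] at hs
      rw [Finset.mem_Iic]
      omega
    · intro s hs
      simp only [Finset.mem_insert, Finset.mem_singleton] at hs
      by_cases h1 : t = 0 ∧ s = 0
      · rw [h1.1, h1.2]; exact hL
      · exact hB _ _ (by omega)
    · rw [Finset.sum_pair (by omega)]
      split_ifs <;> omega
  · refine ⟨{t - 1, t + 1, t + 2}, ?_, ?_, ?_⟩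
    · intro s hs
      simp only [Finset.mem_insert, Finset.mem_singleton] at hs
      rw [Finset.mem_Iic]
      omega
    · intro s hs
      simp only [Finset.mem_insert, Finset.mem_singleton] at hs
      by_cases h1 : t = 0 ∧ s = 0
      · rw [h1.1, h1.2]; exact hL
      · exact hB _ _ (by omega)
    · rw [Finset.sum_insert (by simp; omega), Finset.sum_pair (by omega)]
      split_ifs <;> omega
  · refine ⟨{m}, by simp, ?_, ?_⟩
    · simp only [Finset.mem_singleton, forall_eq]
      exact hB _ _ (by omega)
    · simp [htm.not_ge]

theorem IsPathIn.false_of_forks (hg : IsGraphMatrix Δ) (h : SpectralRadiusLtTwo Δ)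
    (hp : IsPathIn Δ p m) {i j : ℕ} (hi : 0 < i) (hij : i ≤ j) (hj : j < m)
    (hx : ∀ t ≤ m, p t ≠ x) (hy : ∀ t ≤ m, p t ≠ y) (hxy : x ≠ y) (hix : Δ (p i) x = 1)
    (hjy : Δ (p j) y = 1) : False := by
  set g := extendBy (extendBy p m x) (m + 1) y with hgdef
  have hg1 : ∀ t ≤ m, g t = p t := fun t ht => by
    rw [hgdef, extendBy_of_le (by omega), extendBy_of_le ht]
  have hg2 : g (m + 1) = x := by rw [hgdef, extendBy_of_le le_rfl, extendBy_of_lt (by omega)]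
  have hg3 : g (m + 2) = y := by rw [hgdef, extendBy_of_lt (by omega)]
  have hinj : Set.InjOn g (Set.Iic (m + 2)) := by
    refine injOn_extendBy (injOn_extendBy hp.1 hx) fun t _ => ?_
    rcases Nat.lt_or_ge m t with h1 | h1
    · rwa [extendBy_of_lt h1]
    · rw [extendBy_of_le h1]
      exact hy t h1
  have hP : ∀ s t, s ≤ m → t ≤ m → PathRel s t → Δ (g s) (g t) = 1 := fun s t hs ht hst => by
    rw [hg1 s hs, hg1 t ht]
    exact hp.adj_of_pathRel hg.1 hs ht hst
  have hX : Δ (g i) (g (m + 1)) = 1 := by rwa [hg1 i (by omega), hg2]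
  have hY : Δ (g j) (g (m + 2)) = 1 := by rwa [hg1 j (by omega), hg3]
  refine h.false_of_weight hg (Finset.Icc (i - 1) (j + 1) ∪ {m + 1, m + 2}) g
    (hinj.mono ?_) (fun t => if i ≤ t ∧ t ≤ j then 2 else 1) (t₀ := i) ?_ ?_ fun t ht => ?_
  · intro t ht
    simp at ht ⊢
    omega
  · simp; omega
  · simp [hij]
  simp only [Finset.mem_union, Finset.mem_Icc, Finset.mem_insert, Finset.mem_singleton] at ht
  have hleaf : ∀ l, i ≤ l → l ≤ j → Δ (g t) (g l) = 1 → ¬ (i ≤ t ∧ t ≤ j) →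
      ∃ T ⊆ Finset.Icc (i - 1) (j + 1) ∪ {m + 1, m + 2}, (∀ s ∈ T, Δ (g t) (g s) = 1) ∧
        2 * (if i ≤ t ∧ t ≤ j then 2 else 1) ≤ ∑ s ∈ T, if i ≤ s ∧ s ≤ j then 2 else 1 := by
    intro l h1 h2 h3 h4
    refine ⟨{l}, ?_, by simpa using h3, by simp [h1, h2, h4]⟩
    simp only [Finset.singleton_subset_iff, Finset.mem_union, Finset.mem_Icc]
    omega
  by_cases e1 : t = m + 1
  · exact hleaf i le_rfl hij (by rw [e1, hg.1.apply]; exact hX) (by omega)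
  by_cases e2 : t = m + 2
  · exact hleaf j hij le_rfl (by rw [e2, hg.1.apply]; exact hY) (by omega)
  by_cases e3 : t + 1 = i
  · exact hleaf i le_rfl hij (hP _ _ (by omega) (by omega) (by omega)) (by omega)
  by_cases e4 : t = j + 1
  · exact hleaf j hij le_rfl (hP _ _ (by omega) (by omega) (by omega)) (by omega)
  refine ⟨{t - 1, t + 1} ∪ ((if t = i then {m + 1} else ∅) ∪ (if t = j then {m + 2} else ∅)),
    ?_, ?_, ?_⟩
  · intro s hs
    simp only [Finset.mem_union, Finset.mem_Icc, Finset.mem_insert, Finset.mem_singleton] at hs ⊢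
    split_ifs at hs <;> simp at hs <;> omega
  · intro s hs
    by_cases h1 : t = i ∧ s = m + 1
    · rw [h1.1, h1.2]; exact hX
    by_cases h2 : t = j ∧ s = m + 2
    · rw [h2.1, h2.2]; exact hY
    simp only [Finset.mem_union, Finset.mem_insert, Finset.mem_singleton] at hs
    refine hP _ _ ?_ ?_ ?_ <;> split_ifs at hs <;> simp at hs <;> omega
  · have hsum : ∀ l b : ℕ, m < b → ∑ s ∈ (if t = l then {b} else ∅ : Finset ℕ),
        (if i ≤ s ∧ s ≤ j then 2 else 1) = if t = l then 1 else 0 := by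
      intro l b hb
      by_cases e : t = l
      · rw [if_pos e, if_pos e, Finset.sum_singleton, if_neg (by omega)]
      · rw [if_neg e, if_neg e, Finset.sum_empty]
    rw [Finset.sum_union, Finset.sum_union, Finset.sum_pair (by omega), hsum _ _ (by omega),
      hsum _ _ (by omega)]
    · split_ifs <;> omega
    · split_ifs <;> simp
    · split_ifs <;> simp <;> omega

/-- Exclusion of the extended diagram of type `E₆`. -/
theorem IsPathIn.false_of_arms_two_two_two (hg : IsGraphMatrix Δ) (h : SpectralRadiusLtTwo Δ)
    (hp : IsPathIn Δ p 4) (hx : ∀ t ≤ 4, p t ≠ x) (hy : ∀ t ≤ 4, p t ≠ y) (hxy : x ≠ y)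
    (hadj : Δ (p 2) x = 1) (hadj' : Δ x y = 1) : False := by
  have hE : ∀ t ≤ 5, extendBy p 4 x t ≠ y := fun t _ => by
    rcases Nat.lt_or_ge 4 t with h1 | h1
    · rwa [extendBy_of_lt h1]
    · rw [extendBy_of_le h1]
      exact hy t h1
  have hle : ∀ t ≤ 5, extendBy (extendBy p 4 x) 5 y t = extendBy p 4 x t :=
    fun t ht => extendBy_of_le ht
  have hX : Δ (extendBy (extendBy p 4 x) 5 y 5) (extendBy (extendBy p 4 x) 5 y 6) = 1 := by
    rw [extendBy_of_le le_rfl, extendBy_of_lt (by omega), extendBy_of_lt (by omega)]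
    exact hadj'
  refine h.false_of_weight hg (Finset.Iic 6) (extendBy (extendBy p 4 x) 5 y)
    (by simpa using injOn_extendBy (injOn_extendBy hp.1 hx) hE)
    (fun t => [1, 2, 3, 2, 1, 2, 1].getD t 0) (t₀ := 0) (by simp) (by simp) fun t ht =>
      ⟨(Finset.Iic 6).filter fun s => BranchRel 2 6 t s ∨ (t = 5 ∧ s = 6) ∨ (s = 5 ∧ t = 6),
        Finset.filter_subset _ _, fun s hs => ?_, ?_⟩
  · rcases (Finset.mem_filter.1 hs).2 with h1 | ⟨rfl, rfl⟩ | ⟨rfl, rfl⟩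
    · rw [hle t (by omega), hle s (by omega)]
      exact hp.adj_of_branchRel hg.1 (by omega) hadj h1
    · exact hX
    · rw [hg.1.apply]
      exact hX
  · revert t
    decide

/-- Exclusion of the extended diagram of type `E₇`. -/
theorem IsPathIn.false_of_arms_three_three (hg : IsGraphMatrix Δ) (h : SpectralRadiusLtTwo Δ)
    (hp : IsPathIn Δ p 6) (hx : ∀ t ≤ 6, p t ≠ x) (hadj : Δ (p 3) x = 1) : False := by
  refine h.false_of_weight hg (Finset.Iic 7) (extendBy p 6 x)
    (by simpa using injOn_extendBy hp.1 hx) (fun t => [1, 2, 3, 4, 3, 2, 1, 2].getD t 0)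
    (t₀ := 0) (by simp) (by simp) fun t ht =>
      ⟨(Finset.Iic 7).filter (BranchRel 3 8 t), Finset.filter_subset _ _, fun s hs =>
        hp.adj_of_branchRel hg.1 (by omega) hadj (Finset.mem_filter.1 hs).2, ?_⟩
  revert t
  decide

/-- Exclusion of the extended diagram of type `E₈`. -/
theorem IsPathIn.false_of_arms_two_five (hg : IsGraphMatrix Δ) (h : SpectralRadiusLtTwo Δ)
    (hp : IsPathIn Δ p 7) (hx : ∀ t ≤ 7, p t ≠ x) (hadj : Δ (p 2) x = 1) : False := by
  refine h.false_of_weight hg (Finset.Iic 8) (extendBy p 7 x)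
    (by simpa using injOn_extendBy hp.1 hx) (fun t => [2, 4, 6, 5, 4, 3, 2, 1, 3].getD t 0)
    (t₀ := 0) (by simp) (by simp) fun t ht =>
      ⟨(Finset.Iic 8).filter (BranchRel 2 9 t), Finset.filter_subset _ _, fun s hs =>
        hp.adj_of_branchRel hg.1 (by omega) hadj (Finset.mem_filter.1 hs).2, ?_⟩
  revert t
  decide

/-! ### The classification -/

theorem exists_tadpole_labelling (hg : IsGraphMatrix Δ) (hc : IsConnectedMatrix Δ)
    (h : SpectralRadiusLtTwo Δ) {a : Fin N} (ha : Δ a a = 1) :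
    ∃ σ : Equiv.Perm (Fin N), ∀ i j, Δ i j = tadpoleAdj N (σ i) (σ j) := by
  obtain ⟨m, p, hp0, hp, hmax⟩ := exists_longest_path (Δ := Δ) (fun p => p 0 = a) ⟨fun _ => a, rfl⟩
  have hloop : Δ (p 0) (p 0) = 1 := by rwa [hp0]
  have hsurj : ∀ v, ∃ t ≤ m, p t = v := by
    by_contra! ⟨v, hv⟩
    obtain ⟨_, ⟨i, hi, rfl⟩, x, hx, hadj⟩ := hc.exists_adj hg (S := p '' Set.Iic m)
      (Set.mem_image_of_mem p (Set.mem_Iic.2 (Nat.zero_le m))) (b := v)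
      (by rintro ⟨t, ht, e⟩; exact hv t ht e)
    have hx' : ∀ t ≤ m, p t ≠ x := fun t ht e => hx ⟨t, ht, e⟩
    rcases (Set.mem_Iic.1 hi).lt_or_eq with hlt | rfl
    · exact (hp.mono hlt).false_of_loop_of_fork hg h hloop (fun t ht => hx' t (by omega)) hadj
    · have := hmax _ _ (by rwa [extendBy_of_le (Nat.zero_le _)]) (hp.append hx' hadj)
      omega
  refine (exists_perm_of_labelling hg hp.1 hsurj TadpoleRel fun s hs t ht => ?_).2
  rcases eq_or_ne s t with rfl | hst
  · rcases Nat.eq_zero_or_pos s with rfl | hpos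
    · simp [hloop]
    · exact iff_of_false (fun e => (hp.mono hs).false_of_loops hg h hpos hloop e) (by omega)
  · rw [hp.adj_iff hg h hs ht hst]
    omega

theorem IsPathIn.two_le_of_longest (hp : IsPathIn Δ p m)
    (hmax : ∀ q k, IsPathIn Δ q k → k ≤ m)
    (hx : ∀ t ≤ m, p t ≠ x) (hy : ∀ t ≤ m, p t ≠ y) (hxy : x ≠ y) {i : ℕ} (hi : i ≤ m)
    (hadj : Δ (p i) x = 1) (hadj' : Δ x y = 1) : i + 2 ≤ m := by
  have h1 := (hp.mono hi).append (fun t ht => hx t (by omega)) hadj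
  refine hmax _ _ (h1.append (x := y) (fun t _ => ?_) ?_)
  · rcases Nat.lt_or_ge i t with h | h
    · rwa [extendBy_of_lt h]
    · rw [extendBy_of_le h]
      exact hy t (by omega)
  · rwa [extendBy_of_lt (by omega)]

theorem IsPathIn.isADEMatrix_of_branch (hg : IsGraphMatrix Δ) (hc : IsConnectedMatrix Δ)
    (h : SpectralRadiusLtTwo Δ) (hnl : ∀ a, Δ a a ≠ 1) (hp : IsPathIn Δ p m)
    (hmax : ∀ q k, IsPathIn Δ q k → k ≤ m) (hx : ∀ t ≤ m, p t ≠ x) {i : ℕ} (hi : 0 < i)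
    (him : 2 * i ≤ m) (hadj : Δ (p i) x = 1) : IsADEMatrix Δ := by
  have hends : ∀ y, (∀ t ≤ m, p t ≠ y) → ∀ j ≤ m, Δ (p j) y = 1 → 0 < j ∧ j < m := by
    intro y hy j hj hjy
    constructor
    · by_contra hj0
      have := hmax _ _ ((hp.reverse hg.1).append (x := y) (fun t _ => hy _ (by omega))
        (by rw [show m - m = j by omega]; exact hjy))
      omega
    · by_contra hjm
      have := hmax _ _ (hp.append hy (by rw [show m = j by omega]; exact hjy))
      omega
  have hsurj : ∀ v, ∃ t ≤ m + 1, extendBy p m x t = v := by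
    by_contra! ⟨v, hv⟩
    obtain ⟨_, ⟨j, hj, rfl⟩, y, hy, hjy⟩ := hc.exists_adj hg
      (S := extendBy p m x '' Set.Iic (m + 1))
      (Set.mem_image_of_mem _ (Set.mem_Iic.2 (Nat.zero_le _))) (b := v)
      (by rintro ⟨t, ht, e⟩; exact hv t ht e)
    have hy' : ∀ t ≤ m, p t ≠ y := fun t ht e =>
      hy ⟨t, Set.mem_Iic.2 (by omega), by rwa [extendBy_of_le ht]⟩
    have hxy : x ≠ y := fun e => hy ⟨m + 1, Set.mem_Iic.2 le_rfl, by rwa [extendBy_of_lt (by omega)]⟩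
    rw [Set.mem_Iic] at hj
    rcases Nat.lt_or_ge m j with hmj | hmj
    · rw [extendBy_of_lt hmj] at hjy
      have h1 := hp.two_le_of_longest hmax hx hy' hxy (by omega) hadj hjy
      have h2 := (hp.reverse hg.1).two_le_of_longest hmax (fun t _ => hx _ (by omega))
        (fun t _ => hy' _ (by omega)) hxy (i := m - i) (by omega)
        (by rw [show m - (m - i) = i by omega]; exact hadj) hjy
      exact (hp.shift (i - 2) (k := 4) (by omega)).false_of_arms_two_two_two hg h
        (fun t _ => hx _ (by omega)) (fun t _ => hy' _ (by omega)) hxy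
        (by rw [show i - 2 + 2 = i by omega]; exact hadj) hjy
    · rw [extendBy_of_le hmj] at hjy
      have := hends y hy' j hmj hjy
      rcases le_total i j with hij | hij
      · exact hp.false_of_forks hg h hi hij this.2 hx hy' hxy hadj hjy
      · exact hp.false_of_forks hg h this.1 hij (by omega) hy' hx hxy.symm hjy hadj
  obtain ⟨rfl, σ, hσ⟩ := exists_perm_of_labelling hg (injOn_extendBy hp.1 hx) hsurj
    (BranchRel i (m + 2)) fun s hs t ht => by
      refine ⟨fun e => ?_, hp.adj_of_branchRel hg.1 (by omega) hadj⟩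
      have hst : s ≠ t := by
        rintro rfl
        exact hnl _ e
      rcases Nat.lt_or_ge m s with hs' | hs'
      · rw [extendBy_of_lt hs', extendBy_of_le (by omega), hg.1.apply] at e
        have := hp.eq_of_adj hg h hx (by omega) (by omega) e hadj
        omega
      rcases Nat.lt_or_ge m t with ht' | ht'
      · rw [extendBy_of_lt ht', extendBy_of_le (by omega)] at e
        have := hp.eq_of_adj hg h hx (by omega) (by omega) e hadj
        omega
      · rw [extendBy_of_le hs', extendBy_of_le ht', hp.adj_iff hg h hs' ht' hst] at e
        omega
  refine ⟨σ, Or.inr ?_⟩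
  rcases Nat.lt_or_ge i 3 with hi3 | hi3
  · obtain rfl | rfl : i = 1 ∨ i = 2 := by omega
    · exact Or.inl ⟨by omega, hσ⟩
    · have : m < 7 := by
        by_contra hm
        exact (hp.mono (by omega : 7 ≤ m)).false_of_arms_two_five hg h
          (fun t ht => hx t (by omega)) hadj
      exact Or.inr ⟨by omega, hσ⟩
  · exact ((hp.shift (i - 3) (k := 6) (by omega)).false_of_arms_three_three hg h
      (fun t _ => hx _ (by omega)) (by rw [show i - 3 + 3 = i by omega]; exact hadj)).elim

theorem isADEMatrix_of_spectralRadiusLtTwo (hN : 0 < N) (hg : IsGraphMatrix Δ)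
    (hc : IsConnectedMatrix Δ) (h : SpectralRadiusLtTwo Δ) (hnl : ∀ a, Δ a a ≠ 1) :
    IsADEMatrix Δ := by
  obtain ⟨m, p, -, hp, hmax'⟩ := exists_longest_path (Δ := Δ) (fun _ => True)
    ⟨fun _ => ⟨0, hN⟩, trivial⟩
  have hmax : ∀ q k, IsPathIn Δ q k → k ≤ m := fun q k => hmax' q k trivial
  by_cases hsurj : ∀ v, ∃ t ≤ m, p t = v
  · obtain ⟨-, σ, hσ⟩ := exists_perm_of_labelling hg hp.1 hsurj PathRel fun s hs t ht => by
      rcases eq_or_ne s t with rfl | hst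
      · exact iff_of_false (hnl _) (by omega)
      · exact hp.adj_iff hg h hs ht hst
    exact ⟨σ, Or.inl hσ⟩
  push Not at hsurj
  obtain ⟨v, hv⟩ := hsurj
  obtain ⟨_, ⟨i, hi, rfl⟩, x, hx, hadj⟩ := hc.exists_adj hg (S := p '' Set.Iic m)
    (Set.mem_image_of_mem p (Set.mem_Iic.2 (Nat.zero_le m))) (b := v)
    (by rintro ⟨t, ht, e⟩; exact hv t ht e)
  rw [Set.mem_Iic] at hi
  have hx' : ∀ t ≤ m, p t ≠ x := fun t ht e => hx ⟨t, ht, e⟩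
  have hadj' : Δ (p (m - (m - i))) x = 1 := by rwa [show m - (m - i) = i by omega]
  have hi0 : i ≠ m := by
    rintro rfl
    have := hmax _ _ (hp.append hx' hadj)
    omega
  have hi1 : 0 < i := by
    by_contra hi1
    have := hmax _ _ ((hp.reverse hg.1).append (x := x) (fun t _ => hx' _ (by omega))
      (by rw [show m - m = i by omega]; exact hadj))
    omega
  rcases le_total (2 * i) m with him | him
  · exact hp.isADEMatrix_of_branch hg hc h hnl hmax hx' hi1 him hadj
  · exact (hp.reverse hg.1).isADEMatrix_of_branch hg hc h hnl hmax (fun t _ => hx' _ (by omega))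
      (by omega) (by omega) hadj'

theorem IsADEMatrix.isBipartiteMatrix (h : IsADEMatrix Δ) : IsBipartiteMatrix Δ := by
  have key : ∀ (R : ℕ → ℕ → Prop) [DecidableRel R] (σ : Equiv.Perm (Fin N)) (f : ℕ → ℕ),
      (∀ i j, Δ i j = if R (σ i) (σ j) then 1 else 0) →
      (∀ s < N, ∀ t < N, R s t → f s % 2 ≠ f t % 2) → IsBipartiteMatrix Δ := by
    intro R _ σ f hR hf
    refine ⟨fun v => decide (f (σ v) % 2 = 0), fun i j hij => ?_⟩
    have hr : R (σ i) (σ j) := by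
      by_contra hr
      exact hij (by rw [hR, if_neg hr])
    have := hf _ (σ i).2 _ (σ j).2 hr
    simp only [ne_eq, decide_eq_decide]
    omega
  obtain ⟨σ, h | ⟨hN, h⟩ | ⟨hN, h⟩⟩ := h
  · exact key PathRel σ id h fun s _ t _ hst => by simp only [id]; omega
  · exact key (BranchRel 1 N) σ (fun t => if t = N - 1 then 0 else t) h fun s _ t _ hst => by
      split_ifs <;> omega
  · exact key (BranchRel 2 N) σ (fun t => if t = N - 1 then 1 else t) h fun s _ t _ hst => by
      split_ifs <;> omega

end Paths

theorem norm_lt_two_classification (N : ℕ) (hN : 0 < N)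
    (Δ : Matrix (Fin N) (Fin N) ℝ) (hg : IsGraphMatrix Δ)
    (hc : IsConnectedMatrix Δ) :
    (SpectralRadiusLtTwo Δ ↔ IsADETMatrix Δ) ∧
    (IsADETMatrix Δ → (IsBipartiteMatrix Δ ↔ IsADEMatrix Δ)) := by
  refine ⟨⟨fun h => ?_, fun h => h.spectralRadiusLtTwo hg.1⟩, fun h => ⟨?_, fun h' =>
    h'.isBipartiteMatrix⟩⟩
  · by_cases hl : ∃ a, Δ a a = 1
    · obtain ⟨a, ha⟩ := hl
      exact Or.inr (exists_tadpole_labelling hg hc h ha)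
    · push Not at hl
      exact Or.inl (isADEMatrix_of_spectralRadiusLtTwo hN hg hc h hl)
  · rintro ⟨f, hf⟩
    refine h.resolve_right ?_
    rintro ⟨σ, hσ⟩
    refine hf (σ.symm ⟨0, hN⟩) (σ.symm ⟨0, hN⟩) ?_ rfl
    simp [hσ, tadpoleAdj]
end

section
/- Let Δ be the adjacency matrix of the Dynkin diagram D_n with Coxeter number h = 2n-2, and define N_k by N_1 = Id, N_2 = Δ, N_{k+1} = Δ N_k − N_{k-1}. Then N_{h-1} is a permutation matrix; it is the identity if n is even, and the nontrivial graph automorphism exchanging the two short legs if n is odd. -/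
open scoped Matrix

/-- The basis vector of the vertex `j`, with `j` a natural number. -/
def dUnit (n j : ℕ) : Fin n → ℝ := fun i => if (i : ℕ) = j then 1 else 0

/-- The basis of the vectors invariant under exchanging the two short legs: the sum of the two
fork vertices for `j = 0`, and the vertex `j` on the long leg for `1 ≤ j ≤ n - 2`. -/
def dSymm (n j : ℕ) : Fin n → ℝ :=
  if j = 0 then dUnit n 0 + dUnit n (n - 1) else dUnit n j

lemma dSymm_zero (n : ℕ) : dSymm n 0 = dUnit n 0 + dUnit n (n - 1) := if_pos rfl

lemma dSymm_of_ne_zero (n : ℕ) {j : ℕ} (hj : j ≠ 0) : dSymm n j = dUnit n j := if_neg hj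

lemma dAdj_mulVec_dUnit {n j : ℕ} (hj : j < n) :
    dAdj n *ᵥ dUnit n j = fun i => dAdj n i ⟨j, hj⟩ := by
  have h : dUnit n j = Pi.single (⟨j, hj⟩ : Fin n) 1 := by
    ext i
    simp [dUnit, Pi.single_apply, Fin.ext_iff]
  rw [h, Matrix.mulVec_single_one]
  rfl

lemma dAdj_mulVec_dSymm_zero {n : ℕ} (hn : 4 ≤ n) :
    dAdj n *ᵥ dSymm n 0 = (2 : ℝ) • dSymm n 1 := by
  rw [dSymm_zero, dSymm_of_ne_zero n one_ne_zero, Matrix.mulVec_add,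
    dAdj_mulVec_dUnit (by omega), dAdj_mulVec_dUnit (by omega)]
  ext i
  have hi := i.isLt
  simp only [dUnit, dAdj, Matrix.of_apply, Pi.add_apply, Pi.smul_apply, smul_eq_mul]
  grind

lemma dAdj_mulVec_dSymm_succ {n j : ℕ} (hj : j + 3 < n) :
    dAdj n *ᵥ dSymm n (j + 1) = dSymm n j + dSymm n (j + 2) := by
  rw [dSymm_of_ne_zero n j.succ_ne_zero, dSymm_of_ne_zero n (j + 1).succ_ne_zero,
    dAdj_mulVec_dUnit (by omega)]
  ext i
  have hi := i.isLt
  rcases Nat.eq_zero_or_pos j with rfl | h0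
  · simp only [dSymm_zero, dUnit, dAdj, Matrix.of_apply, Pi.add_apply]
    grind
  · simp only [dSymm_of_ne_zero n h0.ne', dUnit, dAdj, Matrix.of_apply, Pi.add_apply]
    grind

lemma dAdj_mulVec_dSymm_last {n : ℕ} (hn : 4 ≤ n) :
    dAdj n *ᵥ dSymm n (n - 2) = dSymm n (n - 3) := by
  rw [dSymm_of_ne_zero n (by omega), dSymm_of_ne_zero n (by omega),
    dAdj_mulVec_dUnit (by omega)]
  ext i
  have hi := i.isLt
  simp only [dUnit, dAdj, Matrix.of_apply]
  grind

lemma dAdj_mulVec_dUnit_sub {n : ℕ} (hn : 4 ≤ n) :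
    dAdj n *ᵥ (dUnit n 0 - dUnit n (n - 1)) = 0 := by
  rw [Matrix.mulVec_sub, dAdj_mulVec_dUnit (by omega), dAdj_mulVec_dUnit (by omega)]
  ext i
  have hi := i.isLt
  simp only [dAdj, Matrix.of_apply, Pi.sub_apply, Pi.zero_apply]
  grind

section Fusion

variable {n : ℕ} {Nk : ℕ → Matrix (Fin n) (Fin n) ℝ}

lemma fusion_commute {ι : Type*} [Fintype ι] [DecidableEq ι] {A : Matrix ι ι ℝ}
    {P : ℕ → Matrix ι ι ℝ} (h1 : P 1 = 1) (h2 : P 2 = A)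
    (hrec : ∀ k, 2 ≤ k → P (k + 1) = A * P k - P (k - 1)) (k : ℕ) :
    Commute A (P (k + 1)) := by
  induction k using Nat.twoStepInduction with
  | zero => rw [h1]; exact Commute.one_right A
  | one => rw [h2]
  | more k ih ih' =>
    rw [hrec (k + 2) (by omega)]
    exact ((Commute.refl A).mul_right ih').sub_right ih

/-- A null vector of the adjacency matrix is multiplied by `(-1) ^ m` at step `2 * m + 1`. -/
lemma fusion_mulVec_of_mulVec_eq_zero {ι : Type*} [Fintype ι] [DecidableEq ι]
    {A : Matrix ι ι ℝ} {P : ℕ → Matrix ι ι ℝ} (h1 : P 1 = 1) (h2 : P 2 = A)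
    (hrec : ∀ k, 2 ≤ k → P (k + 1) = A * P k - P (k - 1)) {v : ι → ℝ} (hv : A *ᵥ v = 0)
    (m : ℕ) : P (2 * m + 1) *ᵥ v = (-1 : ℝ) ^ m • v := by
  induction m with
  | zero => simp [h1]
  | succ m ih =>
    have h : P (2 * m + 3) = A * P (2 * m + 2) - P (2 * m + 1) := hrec (2 * m + 2) (by omega)
    rw [show 2 * (m + 1) + 1 = 2 * m + 3 by ring, h, Matrix.sub_mulVec,
      (fusion_commute h1 h2 hrec (2 * m + 1)).eq, ← Matrix.mulVec_mulVec, hv, ih]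
    simp [pow_succ]

/-- Going down the long leg, from its end to the fork. -/
lemma fusion_mulVec_dSymm_down (hn : 4 ≤ n) (h1 : Nk 1 = 1) (h2 : Nk 2 = dAdj n)
    (hrec : ∀ k, 2 ≤ k → Nk (k + 1) = dAdj n * Nk k - Nk (k - 1)) (k : ℕ) (hk : k ≤ n - 2) :
    Nk (k + 1) *ᵥ dSymm n (n - 2) = dSymm n (n - 2 - k) := by
  induction k using Nat.twoStepInduction with
  | zero => simp [h1]
  | one =>
    rw [h2, dAdj_mulVec_dSymm_last hn]
    congr 1
  | more k ih ih' =>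
    have h : Nk (k + 3) = dAdj n * Nk (k + 2) - Nk (k + 1) := hrec (k + 2) (by omega)
    rw [h, Matrix.sub_mulVec, ← Matrix.mulVec_mulVec, ih' (by omega), ih (by omega)]
    obtain ⟨j, rfl⟩ : ∃ j, n = k + 2 + j + 2 := ⟨n - 2 - (k + 2), by omega⟩
    rw [show k + 2 + j + 2 - 2 - (k + 1) = j + 1 by omega,
      show k + 2 + j + 2 - 2 - k = j + 2 by omega,
      show k + 2 + j + 2 - 2 - (k + 2) = j by omega,
      dAdj_mulVec_dSymm_succ (by omega), add_sub_cancel_right]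

/-- Going back up the long leg, from the fork to its end. -/
lemma fusion_mulVec_dSymm_up (hn : 4 ≤ n) (h1 : Nk 1 = 1) (h2 : Nk 2 = dAdj n)
    (hrec : ∀ k, 2 ≤ k → Nk (k + 1) = dAdj n * Nk k - Nk (k - 1)) (j : ℕ) (hj : j ≤ n - 2) :
    Nk (n - 1 + j) *ᵥ dSymm n (n - 2) = dSymm n j := by
  have hfork : Nk (n - 1) *ᵥ dSymm n (n - 2) = dSymm n 0 := by
    have h := fusion_mulVec_dSymm_down hn h1 h2 hrec (n - 2) le_rfl
    rwa [Nat.sub_self, show n - 2 + 1 = n - 1 by omega] at h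
  induction j using Nat.twoStepInduction with
  | zero => exact hfork
  | one =>
    have h := fusion_mulVec_dSymm_down hn h1 h2 hrec (n - 3) (by omega)
    rw [show n - 3 + 1 = n - 1 - 1 by omega, show n - 2 - (n - 3) = 1 by omega] at h
    rw [hrec (n - 1) (by omega), Matrix.sub_mulVec, ← Matrix.mulVec_mulVec, hfork, h,
      dAdj_mulVec_dSymm_zero hn, two_smul, add_sub_cancel_right]
  | more j ih ih' =>
    have h := hrec (n - 1 + (j + 1)) (by omega)
    rw [show n - 1 + (j + 1) - 1 = n - 1 + j by omega] at h
    rw [show n - 1 + (j + 2) = n - 1 + (j + 1) + 1 from rfl, h, Matrix.sub_mulVec,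
      ← Matrix.mulVec_mulVec, ih' (by omega), ih (by omega),
      dAdj_mulVec_dSymm_succ (by omega), add_sub_cancel_left]

/-- At step `h - 1`, every vector invariant under exchanging the short legs is fixed. -/
lemma fusion_last_mulVec_dSymm (hn : 4 ≤ n) (h1 : Nk 1 = 1) (h2 : Nk 2 = dAdj n)
    (hrec : ∀ k, 2 ≤ k → Nk (k + 1) = dAdj n * Nk k - Nk (k - 1)) (j : ℕ) (hj : j ≤ n - 2) :
    Nk (2 * n - 3) *ᵥ dSymm n j = dSymm n j := by
  have hend : Nk (2 * n - 3) *ᵥ dSymm n (n - 2) = dSymm n (n - 2) := by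
    have h := fusion_mulVec_dSymm_up hn h1 h2 hrec (n - 2) le_rfl
    rwa [show n - 1 + (n - 2) = 2 * n - 3 by omega] at h
  have hcomm : Commute (dAdj n) (Nk (2 * n - 3)) := by
    have h := fusion_commute h1 h2 hrec (2 * n - 4)
    rwa [show 2 * n - 4 + 1 = 2 * n - 3 by omega] at h
  suffices H : ∀ k, Nk (2 * n - 3) *ᵥ (Nk (k + 1) *ᵥ dSymm n (n - 2)) =
      Nk (k + 1) *ᵥ dSymm n (n - 2) by
    have h := H (n - 2 - j)
    rwa [fusion_mulVec_dSymm_down hn h1 h2 hrec _ (Nat.sub_le _ _), Nat.sub_sub_self hj] at h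
  intro k
  induction k using Nat.twoStepInduction with
  | zero => simpa [h1] using hend
  | one => rw [h2, Matrix.mulVec_mulVec, ← hcomm.eq, ← Matrix.mulVec_mulVec, hend]
  | more k ih ih' =>
    have h : Nk (k + 3) = dAdj n * Nk (k + 2) - Nk (k + 1) := hrec (k + 2) (by omega)
    rw [h, Matrix.sub_mulVec, Matrix.mulVec_sub, ih, ← Matrix.mulVec_mulVec,
      Matrix.mulVec_mulVec _ (Nk (2 * n - 3)), ← hcomm.eq, ← Matrix.mulVec_mulVec, ih']

end Fusion

lemma matrix_ext_dUnit {n : ℕ} {A B : Matrix (Fin n) (Fin n) ℝ}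
    (h : ∀ j, j < n → A *ᵥ dUnit n j = B *ᵥ dUnit n j) : A = B := by
  refine Matrix.ext_of_mulVec_single fun j => ?_
  have hj : dUnit n j = Pi.single j 1 := by
    ext i
    simp [dUnit, Pi.single_apply, Fin.ext_iff]
  rw [← hj]
  exact h j j.isLt

/-- Matrices agree if they agree on the vectors invariant under exchanging the two short legs
and on the difference of the fork vertices. -/
lemma matrix_ext_dSymm {n : ℕ} (hn : 4 ≤ n) {A B : Matrix (Fin n) (Fin n) ℝ}
    (hs : ∀ j, j ≤ n - 2 → A *ᵥ dSymm n j = B *ᵥ dSymm n j)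
    (ha : A *ᵥ (dUnit n 0 - dUnit n (n - 1)) = B *ᵥ (dUnit n 0 - dUnit n (n - 1))) : A = B := by
  have h0 : dUnit n 0 = (1 / 2 : ℝ) • (dSymm n 0 + (dUnit n 0 - dUnit n (n - 1))) := by
    rw [dSymm_zero]
    module
  have hl : dUnit n (n - 1) = (1 / 2 : ℝ) • (dSymm n 0 - (dUnit n 0 - dUnit n (n - 1))) := by
    rw [dSymm_zero]
    module
  refine matrix_ext_dUnit fun j hj => ?_
  rcases Nat.eq_zero_or_pos j with rfl | hpos
  · rw [h0, Matrix.mulVec_smul, Matrix.mulVec_smul, Matrix.mulVec_add, Matrix.mulVec_add, ha,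
      hs 0 (Nat.zero_le _)]
  · rcases Nat.lt_or_ge j (n - 1) with hlt | hge
    · have h := hs j (by omega)
      rwa [dSymm_of_ne_zero n hpos.ne'] at h
    · rw [show j = n - 1 by omega, hl, Matrix.mulVec_smul, Matrix.mulVec_smul,
        Matrix.mulVec_sub A (dSymm n 0), Matrix.mulVec_sub B (dSymm n 0), ha, hs 0 (Nat.zero_le _)]

lemma of_perm_mulVec {ι : Type*} [Fintype ι] [DecidableEq ι] (σ : Equiv.Perm ι) (v : ι → ℝ) :
    (Matrix.of fun i j => if σ i = j then (1 : ℝ) else 0) *ᵥ v = v ∘ σ := by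
  ext i
  simp [Matrix.mulVec, dotProduct]

theorem fusion_recursion_D (n : ℕ) (hn : 4 ≤ n)
    (Nk : ℕ → Matrix (Fin n) (Fin n) ℝ)
    (h1 : Nk 1 = 1) (h2 : Nk 2 = dAdj n)
    (hrec : ∀ k, 2 ≤ k → Nk (k + 1) = dAdj n * Nk k - Nk (k - 1)) :
    (Even n → Nk (2 * n - 3) = 1) ∧
    (Odd n → Nk (2 * n - 3) = Matrix.of fun i j : Fin n =>
      if Equiv.swap (⟨0, by omega⟩ : Fin n) (⟨n - 1, by omega⟩ : Fin n) i = j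
        then 1 else 0) := by
  have hs := fusion_last_mulVec_dSymm hn h1 h2 hrec
  have ha := fusion_mulVec_of_mulVec_eq_zero h1 h2 hrec (dAdj_mulVec_dUnit_sub hn) (n - 2)
  rw [show 2 * (n - 2) + 1 = 2 * n - 3 by omega] at ha
  constructor
  · intro he
    have hpow : (-1 : ℝ) ^ (n - 2) = 1 := (he.tsub even_two).neg_one_pow
    refine matrix_ext_dSymm hn (fun j hj => ?_) ?_
    · rw [hs j hj, Matrix.one_mulVec]
    · rw [ha, hpow, one_smul, Matrix.one_mulVec]
  · intro ho
    have hpow : (-1 : ℝ) ^ (n - 2) = -1 :=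
      (Nat.Odd.sub_even (by omega) ho even_two).neg_one_pow
    refine matrix_ext_dSymm hn (fun j hj => ?_) ?_
    · rw [hs j hj, of_perm_mulVec]
      ext i
      have hi := i.isLt
      rcases Nat.eq_zero_or_pos j with rfl | h0
      · simp only [dSymm_zero, dUnit, Function.comp_apply, Equiv.swap_apply_def, Pi.add_apply]
        grind
      · simp only [dSymm_of_ne_zero n h0.ne', dUnit, Function.comp_apply, Equiv.swap_apply_def]
        grind
    · rw [ha, hpow, of_perm_mulVec]
      ext i
      have hi := i.isLt
      simp only [dUnit, Function.comp_apply, Equiv.swap_apply_def, Pi.smul_apply, Pi.sub_apply,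
        smul_eq_mul]
      grind
end
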